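/- arXiv:1306.2010 — 3 statements merged into one kernel-verified Lean document; each statement's English description precedes it below -/
import Mathlib

section
/- Let (Y, dist) be a metric space and let N : Y → ℝ≥0 be a Borel measurable function such that for every c > 0 the sublevel set {y ∈ Y | N y ≤ c} is sequentially compact. Let C > 0 and let f_n : [0,1] → Y (n ∈ ℕ) be maps satisfying dist(f_n t, f_n t') ≤ C·|t − t'|^{1/2} for all n and all t, t' ∈ [0,1], and ∫₀¹ N(f_n t) dt < C for every n. Then there exist a strictly increasing sequence of indices n_k, a map f : [0,1] → Y, and a set S ⊆ [0,1] of full Lebesgue measure such that f_{n_k}(t) → f(t) in Y for every t ∈ S, dist(f t, f t') ≤ C·|t − t'|^{1/2} for all t, t' ∈ S, and ∫_S N(f t) dt ≤ C. -/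
open MeasureTheory Set Filter

/-- Markov's inequality on an interval: a function whose integral over `[0,1]` is less than `C`
takes a value at most `C / (b - a)` on `[a,b]`. -/
lemma exists_le_div_of_lintegral_lt {u : ℝ → NNReal} {C a b : ℝ} (ha : 0 ≤ a) (hab : a < b)
    (hb : b ≤ 1) (hu : (∫⁻ t in Icc (0:ℝ) 1, (u t : ENNReal)) < ENNReal.ofReal C) :
    ∃ t ∈ Icc a b, (u t : ℝ) ≤ C / (b - a) := by
  by_contra! h
  have hba : 0 < b - a := sub_pos.2 hab
  refine hu.not_ge ?_
  calc ENNReal.ofReal C = ∫⁻ _ in Icc a b, ENNReal.ofReal (C / (b - a)) := by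
        rw [setLIntegral_const, Real.volume_Icc, ← ENNReal.ofReal_mul' hba.le,
          div_mul_cancel₀ _ hba.ne']
    _ ≤ ∫⁻ t in Icc a b, (u t : ENNReal) := by
        refine setLIntegral_mono' measurableSet_Icc fun t ht => ?_
        rw [← ENNReal.ofReal_coe_nnreal]
        exact ENNReal.ofReal_le_ofReal (h t ht).le
    _ ≤ _ := lintegral_mono_set (Icc_subset_Icc ha hb)

/-- If each `K i` is compact, a sequence of sequences in `K` has a subsequence converging in every
coordinate. -/
lemma exists_strictMono_forall_tendsto {ι Y : Type*} [Countable ι] [MetricSpace Y]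
    {K : ι → Set Y} (hK : ∀ i, IsSeqCompact (K i)) {x : ℕ → ι → Y} (hx : ∀ n i, x n i ∈ K i) :
    ∃ φ : ℕ → ℕ, StrictMono φ ∧
      ∀ i, ∃ y, Tendsto (fun k => x (φ k) i) atTop (nhds y) := by
  obtain ⟨y, -, φ, hφ, hy⟩ := (isCompact_univ_pi fun i => (hK i).isCompact).isSeqCompact
    (x := x) fun n i _ => hx n i
  exact ⟨φ, hφ, fun i => ⟨y i, tendsto_pi_nhds.1 hy i⟩⟩

lemma frequently_mem_sublevel_of_liminf_lt {Y : Type*} {N : Y → NNReal} {x : ℕ → Y} {r : NNReal}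
    (hr : liminf (fun k => (N (x k) : ENNReal)) atTop < r) :
    (0:ℝ) < r ∧ ∃ᶠ k in atTop, x k ∈ {y : Y | (N y : ℝ) ≤ r} := by
  refine ⟨by exact_mod_cast pos_of_gt hr,
    (frequently_lt_of_liminf_lt (by isBoundedDefault) hr).mono fun k hk => ?_⟩
  have : N (x k) < r := by exact_mod_cast hk
  exact_mod_cast this.le

/-- A function with sequentially compact sublevel sets is sequentially lower semicontinuous. -/
lemma le_liminf_of_isSeqCompact_sublevel {Y : Type*} [MetricSpace Y] {N : Y → NNReal}
    (hcompact : ∀ c : ℝ, 0 < c → IsSeqCompact {y : Y | (N y : ℝ) ≤ c}) {x : ℕ → Y} {y : Y}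
    (hx : Tendsto x atTop (nhds y)) :
    (N y : ENNReal) ≤ liminf (fun k => (N (x k) : ENNReal)) atTop := by
  by_contra! h
  obtain ⟨r, hr, hry⟩ := ENNReal.lt_iff_exists_nnreal_btwn.1 h
  obtain ⟨hr0, hfreq⟩ := frequently_mem_sublevel_of_liminf_lt hr
  have hmem := (hcompact r hr0).isCompact.isClosed.mem_of_frequently_of_tendsto hfreq hx
  have : N y ≤ r := by exact_mod_cast hmem
  exact hry.not_ge (by exact_mod_cast this)

/-- A Cauchy sequence along which a function with sequentially compact sublevel sets has finite
lower limit converges. -/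
lemma CauchySeq.exists_tendsto_of_liminf_lt_top {Y : Type*} [MetricSpace Y] {N : Y → NNReal}
    (hcompact : ∀ c : ℝ, 0 < c → IsSeqCompact {y : Y | (N y : ℝ) ≤ c}) {x : ℕ → Y}
    (hx : CauchySeq x) (hlim : liminf (fun k => (N (x k) : ENNReal)) atTop < ⊤) :
    ∃ y, Tendsto x atTop (nhds y) := by
  obtain ⟨r, hr, -⟩ := ENNReal.lt_iff_exists_nnreal_btwn.1 hlim
  obtain ⟨hr0, hfreq⟩ := frequently_mem_sublevel_of_liminf_lt hr
  obtain ⟨y, -, ψ, hψ, hy⟩ := (hcompact r hr0).subseq_of_frequently_in hfreq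
  exact ⟨y, tendsto_nhds_of_cauchySeq_of_subseq hx hψ.tendsto_atTop hy⟩

/-- Every point of `[0,1]` is arbitrarily close to a rational subinterval of `[0,1]`. -/
lemma exists_rat_Icc_subset_ball {t δ : ℝ} (ht : t ∈ Icc (0:ℝ) 1) (hδ : 0 < δ) :
    ∃ p : ℚ × ℚ, (0 ≤ p.1 ∧ p.1 < p.2 ∧ p.2 ≤ 1) ∧
      ∀ s ∈ Icc (p.1 : ℝ) p.2, |t - s| < δ := by
  obtain ⟨ht0, ht1⟩ := ht
  have h : max 0 (t - δ) < min 1 (t + δ) := by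
    simp only [max_lt_iff, lt_min_iff]
    exact ⟨⟨one_pos, by linarith⟩, by linarith, by linarith⟩
  obtain ⟨a, ha, ha'⟩ := exists_rat_btwn h
  obtain ⟨b, hab, hb⟩ := exists_rat_btwn ha'
  rw [max_lt_iff] at ha
  rw [lt_min_iff] at hb
  refine ⟨(a, b), ⟨?_, ?_, ?_⟩, fun s hs => ?_⟩
  · exact_mod_cast ha.1.le
  · exact_mod_cast hab
  · exact_mod_cast hb.1.le
  · rw [abs_lt]
    constructor <;> linarith [hs.1, hs.2, ha.2, hb.2]

/-- Proposition 2.1 of the paper: abstract scan-compactness. If `N : Y → ℝ≥0` has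
sequentially compact sublevel sets, and `f n : [0,1] → Y` are uniformly `1/2`-Hölder
with uniformly bounded integrals of `N ∘ f n`, then a subsequence converges pointwise
a.e. to a limit with the same Hölder bound and integral bound. -/
theorem scan_compactness {Y : Type*} [MetricSpace Y] [MeasurableSpace Y] [BorelSpace Y]
    (N : Y → NNReal) (hN : Measurable N)
    (hcompact : ∀ c : ℝ, 0 < c → IsSeqCompact {y : Y | (N y : ℝ) ≤ c})
    (C : ℝ) (hC : 0 < C) (f : ℕ → ℝ → Y)
    (hHolder : ∀ n : ℕ, ∀ t ∈ Set.Icc (0:ℝ) 1, ∀ t' ∈ Set.Icc (0:ℝ) 1,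
      dist (f n t) (f n t') ≤ C * |t - t'| ^ ((1:ℝ)/2))
    (hint : ∀ n : ℕ,
      (∫⁻ t in Set.Icc (0:ℝ) 1, (N (f n t) : ENNReal)) < ENNReal.ofReal C) :
    ∃ φ : ℕ → ℕ, StrictMono φ ∧
      ∃ (g : ℝ → Y) (S : Set ℝ), S ⊆ Set.Icc (0:ℝ) 1 ∧
        volume (Set.Icc (0:ℝ) 1 \ S) = 0 ∧
        (∀ t ∈ S, Tendsto (fun k => f (φ k) t) atTop (nhds (g t))) ∧
        (∀ t ∈ S, ∀ t' ∈ S, dist (g t) (g t') ≤ C * |t - t'| ^ ((1:ℝ)/2)) ∧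
        (∫⁻ t in S, (N (g t) : ENNReal)) ≤ ENNReal.ofReal C := by
  have hmodulus : ∀ ε > 0, ∃ δ > 0, ∀ n, ∀ t ∈ Icc (0:ℝ) 1, ∀ s ∈ Icc (0:ℝ) 1,
      |t - s| < δ → dist (f n t) (f n s) < ε := by
    intro ε hε
    have hcont : Continuous fun r : ℝ => C * |r| ^ ((1:ℝ)/2) :=
      continuous_const.mul (continuous_abs.rpow_const fun _ => Or.inr (by norm_num))
    obtain ⟨δ, hδ, h⟩ := Metric.continuous_iff.1 hcont 0 ε hε
    refine ⟨δ, hδ, fun n t ht s hs hts => (hHolder n t ht s hs).trans_lt ?_⟩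
    have := h (t - s) (by simpa using hts)
    simp only [abs_zero, Real.dist_eq] at this
    rw [Real.zero_rpow (by norm_num), mul_zero, sub_zero] at this
    exact (le_abs_self _).trans_lt this
  let ι := {p : ℚ × ℚ // 0 ≤ p.1 ∧ p.1 < p.2 ∧ p.2 ≤ 1}
  have hpoint : ∀ (n : ℕ) (i : ι), ∃ t ∈ Icc (i.1.1 : ℝ) i.1.2,
      (N (f n t) : ℝ) ≤ C / (i.1.2 - i.1.1) := fun n i =>
    exists_le_div_of_lintegral_lt (by exact_mod_cast i.2.1) (by exact_mod_cast i.2.2.1)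
      (by exact_mod_cast i.2.2.2) (hint n)
  choose τ hτ hτN using hpoint
  have hτ01 : ∀ n i, τ n i ∈ Icc (0:ℝ) 1 := fun n i =>
    Icc_subset_Icc (by exact_mod_cast i.2.1) (by exact_mod_cast i.2.2.2) (hτ n i)
  obtain ⟨φ, hφ, hconv⟩ := exists_strictMono_forall_tendsto
    (K := fun i : ι => {y : Y | (N y : ℝ) ≤ C / (i.1.2 - i.1.1)})
    (fun i => hcompact _ (div_pos hC (sub_pos.2 (by exact_mod_cast i.2.2.1))))
    (x := fun n i => f n (τ n i)) hτN
  have hcauchy : ∀ t ∈ Icc (0:ℝ) 1, CauchySeq fun k => f (φ k) t := by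
    intro t ht
    refine Metric.cauchySeq_iff.2 fun ε hε => ?_
    obtain ⟨δ, hδ, hδε⟩ := hmodulus (ε / 3) (by positivity)
    obtain ⟨p, hp, hpδ⟩ := exists_rat_Icc_subset_ball ht hδ
    obtain ⟨y, hy⟩ := hconv ⟨p, hp⟩
    obtain ⟨K, hK⟩ := Metric.cauchySeq_iff.1 hy.cauchySeq (ε / 3) (by positivity)
    refine ⟨K, fun m hm n hn => ?_⟩
    have hclose : ∀ k, dist (f (φ k) t) (f (φ k) (τ (φ k) ⟨p, hp⟩)) < ε / 3 := fun k =>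
      hδε _ t ht _ (hτ01 _ _) (hpδ _ (hτ _ ⟨p, hp⟩))
    have htri := dist_triangle4_right (f (φ m) t) (f (φ n) t)
      (f (φ m) (τ (φ m) ⟨p, hp⟩)) (f (φ n) (τ (φ n) ⟨p, hp⟩))
    linarith [hclose m, hclose n, hK m hm n hn]
  have hmeas : ∀ n, AEMeasurable (fun t => (N (f n t) : ENNReal))
      (volume.restrict (Icc (0:ℝ) 1)) := by
    intro n
    have hcont : ContinuousOn (f n) (Icc 0 1) := Metric.continuousOn_iff.2 fun t ht ε hε => by
      obtain ⟨δ, hδ, h⟩ := hmodulus ε hε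
      exact ⟨δ, hδ, fun s hs hst => h n s hs t ht hst⟩
    exact (measurable_coe_nnreal_ennreal.comp hN).comp_aemeasurable
      (hcont.aemeasurable measurableSet_Icc)
  let L : ℝ → ENNReal := fun t => liminf (fun k => (N (f (φ k) t) : ENNReal)) atTop
  have hL : ∫⁻ t in Icc (0:ℝ) 1, L t ≤ ENNReal.ofReal C :=
    (lintegral_liminf_le' fun k => hmeas (φ k)).trans <|
      liminf_le_of_le (by isBoundedDefault) fun b hb => by
        obtain ⟨k, hk⟩ := hb.exists
        exact hk.trans (hint (φ k)).le
  have hLmeas : AEMeasurable L (volume.restrict (Icc (0:ℝ) 1)) := by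
    simp only [L, liminf_eq_iSup_iInf_of_nat]
    exact AEMeasurable.iSup fun n => AEMeasurable.iInf fun k => AEMeasurable.iInf fun _ =>
      hmeas (φ k)
  have hLtop : ∀ᵐ t ∂volume.restrict (Icc (0:ℝ) 1), L t < ⊤ :=
    ae_lt_top' hLmeas (hL.trans_lt ENNReal.ofReal_lt_top).ne
  let S : Set ℝ := {t ∈ Icc (0:ℝ) 1 | ∃ y, Tendsto (fun k => f (φ k) t) atTop (nhds y)}
  have hg : ∀ t, ∃ y, t ∈ S → Tendsto (fun k => f (φ k) t) atTop (nhds y) := fun t => by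
    by_cases ht : t ∈ S
    · exact ht.2.imp fun _ h _ => h
    · exact ⟨f 0 0, fun h => absurd h ht⟩
  choose g hg using hg
  have hSsub : S ⊆ Icc 0 1 := fun t ht => ht.1
  have hSae : ∀ᵐ t ∂volume.restrict (Icc (0:ℝ) 1), t ∈ S := by
    filter_upwards [hLtop, ae_restrict_mem measurableSet_Icc] with t htop ht
    exact ⟨ht, (hcauchy t ht).exists_tendsto_of_liminf_lt_top hcompact htop⟩
  refine ⟨φ, hφ, g, S, hSsub, ?_, hg, fun t ht t' ht' => ?_, ?_⟩
  · have h := (ae_restrict_iff' measurableSet_Icc).1 hSae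
    rw [ae_iff] at h
    convert h using 2
    ext t
    simp [and_assoc]
  · exact le_of_tendsto ((hg t ht).dist (hg t' ht')) <| Eventually.of_forall fun k =>
      hHolder (φ k) t ht.1 t' ht'.1
  · calc ∫⁻ t in S, (N (g t) : ENNReal) ≤ ∫⁻ t in Icc (0:ℝ) 1, (N (g t) : ENNReal) :=
          lintegral_mono_set hSsub
      _ ≤ ∫⁻ t in Icc (0:ℝ) 1, L t := lintegral_mono_ae <| hSae.mono fun t ht =>
          le_liminf_of_isSeqCompact_sublevel hcompact (hg t ht)
      _ ≤ _ := hL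
end

section
/- Let n ≥ 1 and let M denote the space of real n×n matrices with the operator (or Frobenius) norm and matrix commutator [P,Q] = PQ − QP. Let 0 < r, let Ω := {x ∈ ℝ⁵ : r < |x| < 2r} be the open annulus, and let A_1, …, A_5 : Ω → M be measurable with ∫_Ω ‖A_k‖² < ∞ for each k. Let F_{ij} : Ω → M (1 ≤ i, j ≤ 5) be measurable with ∫_Ω ‖F_{ij}‖² < ∞, and assume the distributional curvature identity: for all i, j and every smooth compactly supported φ : Ω → ℝ, ∫_Ω F_{ij} φ = −∫_Ω (A_j ∂_i φ − A_i ∂_j φ) + ∫_Ω [A_i, A_j] φ. Assume moreover that A has no radial component: Σ_{k=1}^5 x_k A_k(x) = 0 for a.e. x ∈ Ω. For ρ ∈ (r, 2r) define the slice Ã(ρ) : S⁴ → M⁵ by Ã(ρ)(ω) := ρ·(A_1(ρω), …, A_5(ρω)) (defined for a.e. ρ by Fubini). Then there is a universal constant C (independent of r, n, A, F) such that for a.e. pair (t, t') with r < t' < t < 2r: ∫_{S⁴} ‖Ã(t)(ω) − Ã(t')(ω)‖² dσ(ω) ≤ C · (|t − t'| / r²) · ∫_{t' < |x| < t} Σ_{i<j}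 ‖F_{ij}(x)‖² dx, where σ is the canonical surface measure on the unit sphere S⁴ ⊂ ℝ⁵. -/
open MeasureTheory Metric Set Filter

attribute [local instance] Matrix.frobeniusSeminormedAddCommGroup

/-- A measure `σ` on the unit sphere `S⁴ ⊂ ℝ⁵` is the canonical surface measure,
normalized so that the polar-coordinates formula holds. -/
def IsPolarMeasure (σ : Measure (Metric.sphere (0 : EuclideanSpace ℝ (Fin 5)) 1)) : Prop :=
  ∀ g : EuclideanSpace ℝ (Fin 5) → ENNReal, Measurable g →
    ∀ (x : EuclideanSpace ℝ (Fin 5)) (a b : ℝ), 0 ≤ a → a ≤ b →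
      (∫⁻ y in {y : EuclideanSpace ℝ (Fin 5) | dist y x ∈ Set.Icc a b}, g y) =
        ∫⁻ ρ in Set.Icc a b,
          (∫⁻ ω, g (x + ρ • (ω : EuclideanSpace ℝ (Fin 5))) ∂σ) * ENNReal.ofReal (ρ ^ 4)

section Dilation

variable {E : Type*} [NormedAddCommGroup E] [NormedSpace ℝ E] [FiniteDimensional ℝ E]
  [MeasurableSpace E] [BorelSpace E] {μ : Measure E} [μ.IsAddHaarMeasure]

theorem integrable_comp_smul_prod {h : E → ℝ} (hm : Measurable h) (hi : Integrable h μ) (L : ℝ) :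
    Integrable (fun p : ℝ × E => h (p.1 • p.2)) ((volume.restrict (Ioc 1 L)).prod μ) := by
  have hmeas : Measurable (fun p : ℝ × E => h (p.1 • p.2)) := hm.comp measurable_smul
  rw [integrable_prod_iff hmeas.aestronglyMeasurable]
  constructor
  · filter_upwards [ae_restrict_mem measurableSet_Ioc] with s hs
    exact hi.comp_smul (zero_lt_one.trans hs.1).ne'
  · have hc : ContinuousOn (fun s : ℝ => |(s ^ Module.finrank ℝ E)⁻¹| * ∫ x, ‖h x‖ ∂μ) (Icc 1 L) := by
      refine ContinuousOn.mul (ContinuousOn.abs (ContinuousOn.inv₀ (by fun_prop) ?_)) (by fun_prop)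
      intro s hs
      exact (pow_pos (zero_lt_one.trans_le hs.1) _).ne'
    refine (hc.integrableOn_Icc.mono_set Ioc_subset_Icc_self).congr ?_
    refine Eventually.of_forall fun s => ?_
    simpa using (Measure.integral_comp_smul μ (fun x => ‖h x‖) s).symm

theorem integral_mul_dilation_sub {f h φ : E → ℝ} (hf : Integrable f μ)
    (hhm : Measurable h) (hh : Integrable h μ) (hφ : ContDiff ℝ 1 φ) (hφc : HasCompactSupport φ)
    {L : ℝ} (hL : 1 ≤ L)
    (hw : ∀ s ∈ Icc 1 L, ∫ y, h y * φ (s⁻¹ • y) ∂μ =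
      -∫ y, f y * (((Module.finrank ℝ E : ℝ) - 1) * φ (s⁻¹ • y)
        + fderiv ℝ φ (s⁻¹ • y) (s⁻¹ • y)) ∂μ) :
    ∫ x, φ x * (L * f (L • x) - f x - ∫ s in (1 : ℝ)..L, h (s • x)) ∂μ = 0 := by
  set d := Module.finrank ℝ E with hd
  have hL0 : 0 < L := zero_lt_one.trans_le hL
  have hdφ : Continuous (fderiv ℝ φ) := hφ.continuous_fderiv (by norm_num)
  set ψ : E → ℝ := fun z => ((d : ℝ) - 1) * φ z + fderiv ℝ φ z z with hψ
  have hψc : Continuous ψ :=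
    (continuous_const.mul hφ.continuous).add (hdφ.clm_apply continuous_id)
  have hψs : HasCompactSupport ψ := by
    refine (hφc.mul_left).add ((hφc.fderiv (𝕜 := ℝ)).mono ?_)
    intro z hz
    simp only [Function.mem_support] at hz ⊢
    contrapose! hz
    simp [hz]
  obtain ⟨M, hM⟩ := hψc.bounded_above_of_compact_support hψs
  obtain ⟨N, hN⟩ := hφ.continuous.bounded_above_of_compact_support hφc
  have hk : ∀ y : E, ∫ s in (1 : ℝ)..L, -(s ^ (-(d : ℤ)) * ψ (s⁻¹ • y)) =
      L ^ (1 - (d : ℤ)) * φ (L⁻¹ • y) - φ y := by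
    intro y
    have h0 : ∀ s ∈ uIcc 1 L, s ≠ 0 := by
      intro s hs
      rw [uIcc_of_le hL] at hs
      exact (zero_lt_one.trans_le hs.1).ne'
    have := intervalIntegral.integral_eq_sub_of_hasDerivAt (a := 1) (b := L)
      (f := fun s : ℝ => s ^ (1 - (d : ℤ)) * φ (s⁻¹ • y))
      (f' := fun s : ℝ => -(s ^ (-(d : ℤ)) * ψ (s⁻¹ • y))) ?_ ?_
    · simpa using this
    · intro s hs
      have hs0 := h0 s hs
      have h1 := hasDerivAt_zpow (1 - (d : ℤ)) s (Or.inl hs0)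
      have h2 : HasDerivAt (fun s : ℝ => s⁻¹ • y) (-(s ^ 2)⁻¹ • y) s :=
        (hasDerivAt_inv hs0).smul_const y
      have h3 := ((hφ.differentiable (by norm_num)) (s⁻¹ • y)).hasFDerivAt.comp_hasDerivAt s h2
      refine (h1.mul h3).congr_deriv ?_
      have e1 : (1 - (d : ℤ) - 1) = -(d : ℤ) := by ring
      have e2 : (s : ℝ) ^ (1 - (d : ℤ)) = s * s ^ (-(d : ℤ)) := by
        rw [sub_eq_add_neg, zpow_add₀ hs0, zpow_one]
      rw [e1, e2]
      simp only [hψ, Function.comp, map_smul, smul_eq_mul]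
      push_cast
      field_simp
      ring
    · refine ContinuousOn.intervalIntegrable ?_
      refine (ContinuousOn.mul (continuousOn_id.zpow₀ _ fun s hs => Or.inl (h0 s hs))
        (hψc.comp_continuousOn
          ((continuousOn_id.inv₀ h0).smul continuousOn_const))).neg
  have hI1 : Integrable (fun p : E × ℝ => f p.1 * -(p.2 ^ (-(d : ℤ)) * ψ (p.2⁻¹ • p.1)))
      (μ.prod (volume.restrict (Ioc 1 L))) := by
    have hf' : Integrable (fun p : E × ℝ => f p.1) (μ.prod (volume.restrict (Ioc 1 L))) :=
      hf.comp_fst _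
    refine hf'.mul_bdd (c := M) ?_ ?_
    · refine Measurable.aestronglyMeasurable ?_
      have : Measurable ψ := hψc.measurable
      fun_prop
    · have : ∀ᵐ p : E × ℝ ∂(μ.prod (volume.restrict (Ioc 1 L))), p.2 ∈ Ioc 1 L :=
        Measure.quasiMeasurePreserving_snd.ae (ae_restrict_mem measurableSet_Ioc)
      filter_upwards [this] with p hp
      have h1 : |p.2 ^ (-(d : ℤ))| ≤ 1 := by
        rw [zpow_neg, zpow_natCast, abs_of_nonneg (by have := hp.1; positivity)]
        exact inv_le_one_of_one_le₀ (one_le_pow₀ hp.1.le)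
      have h2 := hM (p.2⁻¹ • p.1)
      rw [norm_neg, norm_mul, Real.norm_eq_abs]
      calc _ ≤ 1 * M := mul_le_mul h1 h2 (norm_nonneg _) zero_le_one
        _ = M := one_mul M
  have hI2 : Integrable (fun p : ℝ × E => φ p.2 * h (p.1 • p.2))
      ((volume.restrict (Ioc 1 L)).prod μ) := by
    refine (integrable_comp_smul_prod hhm hh L).bdd_mul (c := N) ?_ ?_
    · exact (hφ.continuous.comp continuous_snd).aestronglyMeasurable
    · exact Eventually.of_forall fun p => hN p.2
  have key : ∫ y, f y * (L ^ (1 - (d : ℤ)) * φ (L⁻¹ • y) - φ y) ∂μ =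
      ∫ x, φ x * (∫ s in (1 : ℝ)..L, h (s • x)) ∂μ := by
    calc _ = ∫ y, (∫ s in Ioc 1 L, f y * -(s ^ (-(d : ℤ)) * ψ (s⁻¹ • y))) ∂μ := by
          refine integral_congr_ae (Eventually.of_forall fun y => ?_)
          simp only
          rw [← hk y, intervalIntegral.integral_of_le hL, integral_const_mul]
      _ = ∫ s in Ioc 1 L, ∫ y, f y * -(s ^ (-(d : ℤ)) * ψ (s⁻¹ • y)) ∂μ :=
          integral_integral_swap hI1
      _ = ∫ s in Ioc 1 L, ∫ x, φ x * h (s • x) ∂μ := by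
          refine setIntegral_congr_fun measurableSet_Ioc fun s hs => ?_
          have hs0 : 0 < s := zero_lt_one.trans hs.1
          have h1 := hw s (Ioc_subset_Icc_self hs)
          have h2 := Measure.integral_comp_smul_of_nonneg μ
            (fun y => h y * φ (s⁻¹ • y)) s (hR := hs0.le)
          simp only [inv_smul_smul₀ hs0.ne', smul_eq_mul] at h2
          simp only [mul_comm (φ _)]
          rw [h2, h1, ← integral_neg, ← integral_const_mul, zpow_neg, zpow_natCast]
          congr 1
          ext y
          simp only [hψ, ← hd]
          ring
      _ = ∫ x, (∫ s in Ioc 1 L, φ x * h (s • x)) ∂μ := integral_integral_swap hI2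
      _ = _ := by
          simp only [integral_const_mul, intervalIntegral.integral_of_le hL]
  have hφm : AEStronglyMeasurable φ μ := hφ.continuous.aestronglyMeasurable
  have i1 : Integrable (fun x => φ x * (L * f (L • x))) μ :=
    ((hf.comp_smul hL0.ne').const_mul L).bdd_mul hφm (Eventually.of_forall hN)
  have i2 : Integrable (fun x => φ x * f x) μ :=
    hf.bdd_mul hφm (Eventually.of_forall hN)
  have i3 : Integrable (fun x => φ x * ∫ s in (1 : ℝ)..L, h (s • x)) μ := by
    simpa only [intervalIntegral.integral_of_le hL, integral_const_mul] using
      hI2.integral_prod_right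
  have i4 : Integrable (fun y => f y * (L ^ (1 - (d : ℤ)) * φ (L⁻¹ • y))) μ := by
    refine hf.mul_bdd (c := L ^ (1 - (d : ℤ)) * N) ?_ ?_
    · have := hφ.continuous
      exact Continuous.aestronglyMeasurable (by fun_prop)
    · refine Eventually.of_forall fun y => ?_
      rw [norm_mul, Real.norm_of_nonneg (by positivity)]
      exact mul_le_mul_of_nonneg_left (hN _) (by positivity)
  have h5 : ∫ x, φ x * (L * f (L • x)) ∂μ
      = ∫ y, f y * (L ^ (1 - (d : ℤ)) * φ (L⁻¹ • y)) ∂μ := by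
    have h2 := Measure.integral_comp_smul_of_nonneg μ
            (fun y => f y * (L * φ (L⁻¹ • y))) L (hR := hL0.le)
    simp only [inv_smul_smul₀ hL0.ne', smul_eq_mul] at h2
    have : ∀ x, φ x * (L * f (L • x)) = f (L • x) * (L * φ x) := fun x => by ring
    simp only [this]
    rw [h2, ← integral_const_mul, ← hd]
    congr 1
    ext y
    rw [sub_eq_add_neg, zpow_add₀ hL0.ne', zpow_one, zpow_neg, zpow_natCast]
    ring
  have e : ∀ x, φ x * (L * f (L • x) - f x - ∫ s in (1 : ℝ)..L, h (s • x)) =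
      φ x * (L * f (L • x)) - φ x * f x - φ x * ∫ s in (1 : ℝ)..L, h (s • x) := fun x => by ring
  simp only [e]
  have i12 : Integrable (fun x => φ x * (L * f (L • x)) - φ x * f x) μ := i1.sub i2
  rw [integral_sub i12 i3, integral_sub i1 i2, h5, ← key]
  simp only [mul_sub]
  rw [integral_sub i4 (by simpa only [mul_comm] using i2)]
  simp only [mul_comm (φ _), sub_self]

theorem ae_dilation_sub_eq_intervalIntegral {f h : E → ℝ} {U V : Set E} (hU : MeasurableSet U)
    (hV : IsOpen V) (hf : IntegrableOn f U μ) (hhm : Measurable h) (hh : IntegrableOn h U μ)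
    {L : ℝ} (hL : 1 ≤ L) (hVU : ∀ x ∈ V, ∀ s ∈ Icc 1 L, s • x ∈ U)
    (hw : ∀ φ : E → ℝ, ContDiff ℝ (⊤ : ℕ∞) φ → HasCompactSupport φ → tsupport φ ⊆ U →
      ∫ y in U, h y * φ y ∂μ =
        -∫ y in U, f y * (((Module.finrank ℝ E : ℝ) - 1) * φ y + fderiv ℝ φ y y) ∂μ) :
    ∀ᵐ x ∂μ, x ∈ V → L * f (L • x) - f x = ∫ s in (1 : ℝ)..L, h (s • x) := by
  have hL0 : 0 < L := zero_lt_one.trans_le hL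
  have hf' : Integrable (U.indicator f) μ := hf.integrable_indicator hU
  have hh' : Integrable (U.indicator h) μ := hh.integrable_indicator hU
  have hhm' : Measurable (U.indicator h) := hhm.indicator hU
  have hInt : Integrable (fun x => L * U.indicator f (L • x) - U.indicator f x
      - ∫ s in (1 : ℝ)..L, U.indicator h (s • x)) μ := by
    refine (((hf'.comp_smul hL0.ne').const_mul L).sub hf').sub ?_
    simpa only [intervalIntegral.integral_of_le hL] using
      (integrable_comp_smul_prod hhm' hh' L).integral_prod_right
  have hz := hV.ae_eq_zero_of_integral_contDiff_smul_eq_zero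
    (hInt.locallyIntegrable.locallyIntegrableOn V) (fun φ hφ hφc hφV => ?_)
  · filter_upwards [hz] with x hx hxV
    have h1 := hx hxV
    have e1 : U.indicator f (L • x) = f (L • x) :=
      indicator_of_mem (hVU x hxV L ⟨hL, le_rfl⟩) f
    have e2 : U.indicator f x = f x := by
      have := hVU x hxV 1 ⟨le_rfl, hL⟩
      rw [one_smul] at this
      exact indicator_of_mem this f
    have e3 : ∫ s in (1 : ℝ)..L, U.indicator h (s • x) = ∫ s in (1 : ℝ)..L, h (s • x) := by
      refine intervalIntegral.integral_congr fun s hs => ?_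
      rw [uIcc_of_le hL] at hs
      exact indicator_of_mem (hVU x hxV s hs) h
    rw [e1, e2, e3] at h1
    exact sub_eq_zero.1 h1
  · refine integral_mul_dilation_sub hf' hhm' hh' (hφ.of_le (by exact_mod_cast le_top)) hφc hL
      fun s hs => ?_
    have hs0 : 0 < s := zero_lt_one.trans_le hs.1
    have hsupp : tsupport (fun y => φ (s⁻¹ • y)) ⊆ U := by
      have hcl : IsClosed ((fun y : E => s⁻¹ • y) ⁻¹' tsupport φ) :=
        (isClosed_tsupport φ).preimage (continuous_const_smul s⁻¹)
      have hle : tsupport (fun y => φ (s⁻¹ • y)) ⊆ (fun y : E => s⁻¹ • y) ⁻¹' tsupport φ :=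
        closure_minimal (fun y (hy : φ (s⁻¹ • y) ≠ 0) => subset_tsupport φ hy) hcl
      refine hle.trans fun y hy => ?_
      have := hVU _ (hφV hy) s hs
      simpa [smul_inv_smul₀ hs0.ne'] using this
    have h1 := hw (fun y => φ (s⁻¹ • y)) (hφ.comp (contDiff_const_smul s⁻¹))
      (hφc.comp_homeomorph (Homeomorph.smulOfNeZero s⁻¹ (inv_ne_zero hs0.ne'))) hsupp
    have h2 : ∀ y, fderiv ℝ (fun y => φ (s⁻¹ • y)) y y = fderiv ℝ φ (s⁻¹ • y) (s⁻¹ • y) := by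
      intro y
      have hd := ((hφ.differentiable (by simp)) (s⁻¹ • y)).hasFDerivAt.comp y
        ((hasFDerivAt_id (𝕜 := ℝ) y).const_smul s⁻¹)
      have := hd.fderiv
      simp only [Function.comp_def] at this
      rw [this]
      simp
    simp only [h2] at h1
    simp only [← integral_indicator hU] at h1
    simpa only [indicator_mul_left] using h1

end Dilation

theorem ofReal_sq_intervalIntegral_le {g : ℝ → ℝ} (hg : Measurable g) {a b : ℝ} (hab : a ≤ b) :
    ENNReal.ofReal ((∫ s in a..b, g s) ^ 2) ≤
      ENNReal.ofReal (b - a) * ∫⁻ s in Ioc a b, ENNReal.ofReal (g s ^ 2) := by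
  have hsq : ∀ v : ℝ, ENNReal.ofReal (v ^ 2) = ‖v‖ₑ ^ 2 := fun v => by
    rw [← sq_abs, ENNReal.ofReal_pow (abs_nonneg v), Real.enorm_eq_ofReal_abs]
  simp only [hsq]
  have h1 : ‖∫ s in a..b, g s‖ₑ ≤ ∫⁻ s in Ioc a b, ‖g s‖ₑ := by
    rw [intervalIntegral.integral_of_le hab]
    exact enorm_integral_le_lintegral_enorm _
  have h2 := ENNReal.lintegral_mul_le_Lp_mul_Lq (volume.restrict (Ioc a b))
    Real.HolderConjugate.two_two (f := fun _ => 1) (g := fun s => ‖g s‖ₑ)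
    aemeasurable_const hg.enorm.aemeasurable
  simp only [Pi.mul_apply, one_mul, lintegral_const, Measure.restrict_apply_univ,
    Real.volume_Ioc, ENNReal.rpow_two, one_pow] at h2
  calc _ ≤ (ENNReal.ofReal (b - a) ^ (1 / 2 : ℝ) *
        (∫⁻ s in Ioc a b, ‖g s‖ₑ ^ 2) ^ (1 / 2 : ℝ)) ^ 2 := by
        gcongr
        exact h1.trans h2
    _ = _ := by
        rw [mul_pow]
        simp only [← ENNReal.rpow_two, ← ENNReal.rpow_mul]
        norm_num

theorem ae_mem_of_forall_ae_mul_mem {S : Set (ℝ × ℝ)} (hS : MeasurableSet S)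
    (h : ∀ L : ℝ, ∀ᵐ t : ℝ, (L * t, t) ∈ S) : ∀ᵐ p : ℝ × ℝ, p ∈ S := by
  have hT : MeasurableSet {x : ℝ × ℝ | (x.1 * x.2, x.2) ∈ S} := hS.preimage (by fun_prop)
  have h1 : ∀ᵐ t : ℝ, ∀ᵐ L : ℝ, (L * t, t) ∈ S :=
    (Measure.ae_ae_comm (p := fun L t : ℝ => (L * t, t) ∈ S) hT).1 (Eventually.of_forall h)
  have h2 : ∀ᵐ t : ℝ, ∀ᵐ u : ℝ, (u, t) ∈ S := by
    filter_upwards [h1, Measure.ae_ne volume (0 : ℝ)] with t ht ht0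
    have hq := Measure.quasiMeasurePreserving_smul (volume : Measure ℝ) (inv_ne_zero ht0)
    filter_upwards [hq.ae ht] with u hu
    have : t⁻¹ • u * t = u := by simp only [smul_eq_mul]; field_simp
    rwa [this] at hu
  have h3 := (Measure.ae_ae_comm (p := fun u t : ℝ => (u, t) ∈ S) hS).2 h2
  exact (Measure.ae_prod_mem_iff_ae_ae_mem hS).2 h3

section Polar

variable {σ : Measure (Metric.sphere (0 : EuclideanSpace ℝ (Fin 5)) 1)}

theorem IsPolarMeasure.isFiniteMeasure (hσ : IsPolarMeasure σ) : IsFiniteMeasure σ := by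
  have h := hσ (fun _ => 1) measurable_const 0 1 2 zero_le_one one_le_two
  simp only [lintegral_const, one_mul, Measure.restrict_apply_univ] at h
  have hfin : volume {y : EuclideanSpace ℝ (Fin 5) | dist y 0 ∈ Icc (1 : ℝ) 2} < ⊤ :=
    (measure_mono fun y hy => mem_closedBall.2 hy.2).trans_lt
      (measure_closedBall_lt_top (x := (0 : EuclideanSpace ℝ (Fin 5))) (r := 2))
  rw [h] at hfin
  have hle : ∫⁻ _ in Icc (1 : ℝ) 2, σ univ ≤
      ∫⁻ ρ in Icc (1 : ℝ) 2, σ univ * ENNReal.ofReal (ρ ^ 4) := by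
    refine setLIntegral_mono' measurableSet_Icc fun ρ hρ => ?_
    refine le_mul_of_one_le_right' ?_
    exact ENNReal.one_le_ofReal.2 (one_le_pow₀ hρ.1)
  have := hle.trans_lt hfin
  refine ⟨?_⟩
  rw [lintegral_const, Measure.restrict_apply_univ, Real.volume_Icc] at this
  norm_num at this
  exact this

theorem norm_smul_sphere {ρ : ℝ} (hρ : 0 ≤ ρ) (ω : sphere (0 : EuclideanSpace ℝ (Fin 5)) 1) :
    ‖ρ • (ω : EuclideanSpace ℝ (Fin 5))‖ = ρ := by
  rw [norm_smul, norm_eq_of_mem_sphere, mul_one, Real.norm_of_nonneg hρ]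

theorem measurableSet_annulus (a b : ℝ) :
    MeasurableSet {x : EuclideanSpace ℝ (Fin 5) | a < ‖x‖ ∧ ‖x‖ < b} :=
  (measurableSet_lt measurable_const measurable_norm).inter
    (measurableSet_lt measurable_norm measurable_const)

theorem IsPolarMeasure.lintegral_annulus (hσ : IsPolarMeasure σ)
    {g : EuclideanSpace ℝ (Fin 5) → ENNReal} (hg : Measurable g) {a b : ℝ} (ha : 0 ≤ a)
    (hab : a ≤ b) :
    ∫⁻ y in {x : EuclideanSpace ℝ (Fin 5) | a < ‖x‖ ∧ ‖x‖ < b}, g y =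
      ∫⁻ ρ in Ioo a b, (∫⁻ ω, g (ρ • (ω : EuclideanSpace ℝ (Fin 5))) ∂σ)
        * ENNReal.ofReal (ρ ^ 4) := by
  have hm := measurableSet_annulus a b
  have hsub : {x : EuclideanSpace ℝ (Fin 5) | a < ‖x‖ ∧ ‖x‖ < b} ⊆ {x | ‖x‖ ∈ Icc a b} :=
    fun x hx => ⟨hx.1.le, hx.2.le⟩
  have h := hσ _ (hg.indicator hm) 0 a b ha hab
  simp only [dist_zero_right, zero_add] at h
  rw [setLIntegral_indicator hm, inter_eq_left.2 hsub] at h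
  rw [h, ← inter_eq_left.2 (Ioo_subset_Icc_self (a := a) (b := b)),
    ← setLIntegral_indicator measurableSet_Ioo]
  refine setLIntegral_congr_fun measurableSet_Icc fun ρ hρ => ?_
  by_cases hρ' : ρ ∈ Ioo a b
  · rw [indicator_of_mem hρ']
    congr 1
    refine lintegral_congr fun ω => indicator_of_mem ?_ _
    simpa only [mem_ofPred_eq, norm_smul_sphere (ha.trans hρ.1), mem_Ioo] using hρ'
  · rw [indicator_of_notMem hρ']
    convert zero_mul _
    rw [lintegral_eq_zero_of_ae_eq_zero]
    refine Eventually.of_forall fun ω => indicator_of_notMem ?_ _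
    simpa only [mem_ofPred_eq, norm_smul_sphere (ha.trans hρ.1), mem_Ioo] using hρ'

theorem IsPolarMeasure.ae_ae_smul (hσ : IsPolarMeasure σ) {p : EuclideanSpace ℝ (Fin 5) → Prop}
    {a b : ℝ} (ha : 0 ≤ a) (h : ∀ᵐ x : EuclideanSpace ℝ (Fin 5), a < ‖x‖ ∧ ‖x‖ < b → p x) :
    ∀ᵐ ρ : ℝ, ρ ∈ Ioo a b →
      ∀ᵐ ω : sphere (0 : EuclideanSpace ℝ (Fin 5)) 1 ∂σ, p (ρ • (ω : EuclideanSpace ℝ (Fin 5))) := by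
  have := hσ.isFiniteMeasure
  rcases le_or_gt a b with hab | hab
  · obtain ⟨N, hN, hNm, hN0⟩ := exists_measurable_superset_of_null (ae_iff.1 h)
    have hmN : Measurable fun q : ℝ × sphere (0 : EuclideanSpace ℝ (Fin 5)) 1 =>
        N.indicator (1 : EuclideanSpace ℝ (Fin 5) → ENNReal)
          (q.1 • (q.2 : EuclideanSpace ℝ (Fin 5))) :=
      (measurable_one.indicator hNm).comp (by fun_prop)
    have h1 := hσ.lintegral_annulus (measurable_one.indicator hNm) ha hab
    rw [show ∫⁻ y in {x : EuclideanSpace ℝ (Fin 5) | a < ‖x‖ ∧ ‖x‖ < b},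
      N.indicator 1 y = 0 from ?_] at h1
    · have h2 := (lintegral_eq_zero_iff
        (hmN.lintegral_prod_right'.mul (by fun_prop))).1 h1.symm
      rw [EventuallyEq, ae_restrict_iff' measurableSet_Ioo] at h2
      filter_upwards [h2] with ρ hρ hρm
      have hρ0 : 0 < ρ := ha.trans_lt hρm.1
      have h3 : ∫⁻ ω, N.indicator (1 : EuclideanSpace ℝ (Fin 5) → ENNReal)
          (ρ • (ω : EuclideanSpace ℝ (Fin 5))) ∂σ = 0 := by
        have := hρ hρm
        simp only [Pi.zero_apply, Pi.mul_apply, mul_eq_zero, ENNReal.ofReal_eq_zero, not_le.2 (pow_pos hρ0 4),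
          or_false] at this
        exact this
      have h4 := (lintegral_eq_zero_iff (hmN.comp measurable_prodMk_left)).1 h3
      filter_upwards [h4] with ω hω
      by_contra hp
      have hmem : ρ • (ω : EuclideanSpace ℝ (Fin 5)) ∈ N := by
        refine hN ?_
        simp only [mem_ofPred_eq, norm_smul_sphere hρ0.le]
        exact fun hc => hp (hc hρm)
      simp [hmem] at hω
    · rw [lintegral_indicator_one hNm]
      exact Measure.absolutelyContinuous_of_le Measure.restrict_le_self hN0
  · exact Eventually.of_forall fun ρ hρ => absurd (hρ.1.trans hρ.2) (not_lt.2 hab.le)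

theorem IsPolarMeasure.ae_lintegral_slice_sub_le (hσ : IsPolarMeasure σ) {ι : Type*} [Fintype ι]
    {f h : ι → EuclideanSpace ℝ (Fin 5) → ℝ} (hf : ∀ i, Measurable (f i))
    (hh : ∀ i, Measurable (h i)) {r R : ℝ} (hr : 0 < r)
    (H : ∀ L : ℝ, 1 < L → ∀ᵐ x : EuclideanSpace ℝ (Fin 5), r < ‖x‖ ∧ ‖x‖ < R / L →
      ∀ i, L * f i (L • x) - f i x = ∫ s in (1 : ℝ)..L, h i (s • x)) :
    ∀ᵐ p : ℝ × ℝ, r < p.2 → p.2 < p.1 → p.1 < R →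
      ∫⁻ ω, ∑ i, ENNReal.ofReal ((p.1 * f i (p.1 • (ω : EuclideanSpace ℝ (Fin 5)))
          - p.2 * f i (p.2 • (ω : EuclideanSpace ℝ (Fin 5)))) ^ 2) ∂σ ≤
        ENNReal.ofReal ((p.1 - p.2) / r ^ 4) *
          ∫⁻ x in {x : EuclideanSpace ℝ (Fin 5) | p.2 < ‖x‖ ∧ ‖x‖ < p.1},
            ∑ i, ENNReal.ofReal (h i x ^ 2) := by
  have := hσ.isFiniteMeasure
  set G : EuclideanSpace ℝ (Fin 5) → ENNReal := fun x => ∑ i, ENNReal.ofReal (h i x ^ 2) with hG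
  have hGm : Measurable G := by fun_prop
  have hSm : MeasurableSet {p : ℝ × ℝ | r < p.2 → p.2 < p.1 → p.1 < R →
      ∫⁻ ω, ∑ i, ENNReal.ofReal ((p.1 * f i (p.1 • (ω : EuclideanSpace ℝ (Fin 5)))
          - p.2 * f i (p.2 • (ω : EuclideanSpace ℝ (Fin 5)))) ^ 2) ∂σ ≤
        ENNReal.ofReal ((p.1 - p.2) / r ^ 4) *
          ∫⁻ x in {x : EuclideanSpace ℝ (Fin 5) | p.2 < ‖x‖ ∧ ‖x‖ < p.1}, G x} := by
    have hl : Measurable fun p : ℝ × ℝ =>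
        ∫⁻ ω, ∑ i, ENNReal.ofReal ((p.1 * f i (p.1 • (ω : EuclideanSpace ℝ (Fin 5)))
          - p.2 * f i (p.2 • (ω : EuclideanSpace ℝ (Fin 5)))) ^ 2) ∂σ :=
      Measurable.lintegral_prod_right (by unfold Function.uncurry; fun_prop)
    have hr' : Measurable fun p : ℝ × ℝ =>
        ∫⁻ x in {x : EuclideanSpace ℝ (Fin 5) | p.2 < ‖x‖ ∧ ‖x‖ < p.1}, G x := by
      have hset : MeasurableSet {q : (ℝ × ℝ) × EuclideanSpace ℝ (Fin 5) |
          q.1.2 < ‖q.2‖ ∧ ‖q.2‖ < q.1.1} :=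
        (measurableSet_lt (measurable_snd.comp measurable_fst) measurable_snd.norm).inter
          (measurableSet_lt measurable_snd.norm (measurable_fst.comp measurable_fst))
      have h1 := ((hGm.comp measurable_snd).indicator hset).lintegral_prod_right'
        (ν := (volume : Measure (EuclideanSpace ℝ (Fin 5))))
      convert h1 using 2 with p
      rw [← lintegral_indicator (measurableSet_annulus _ _)]
      rfl
    have hle := measurableSet_le hl
      ((Measurable.ennreal_ofReal (f := fun p : ℝ × ℝ => (p.1 - p.2) / r ^ 4)
        (by fun_prop)).mul hr')
    exact (measurableSet_lt measurable_const measurable_snd).imp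
      ((measurableSet_lt measurable_snd measurable_fst).imp
        ((measurableSet_lt measurable_fst measurable_const).imp hle))
  refine ae_mem_of_forall_ae_mul_mem hSm fun L => ?_
  rcases le_or_gt L 1 with hL | hL
  · refine Eventually.of_forall fun t ht1 ht2 => ?_
    have ht0 : 0 < t := hr.trans ht1
    exact absurd ht2 (not_lt.2 (mul_le_of_le_one_left ht0.le hL))
  have hL0 : 0 < L := zero_lt_one.trans hL
  filter_upwards [hσ.ae_ae_smul hr.le (H L hL)] with t ht ht1 ht2 ht3
  simp only at ht1 ht2 ht3 ⊢
  have ht0 : 0 < t := hr.trans ht1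
  have hω : ∀ᵐ ω : sphere (0 : EuclideanSpace ℝ (Fin 5)) 1 ∂σ,
      ∑ i, ENNReal.ofReal ((L * t * f i ((L * t) • (ω : EuclideanSpace ℝ (Fin 5)))
          - t * f i (t • (ω : EuclideanSpace ℝ (Fin 5)))) ^ 2) ≤
        ENNReal.ofReal (L * t - t) *
          ∫⁻ ρ in Ioc t (L * t), G (ρ • (ω : EuclideanSpace ℝ (Fin 5))) := by
    filter_upwards [ht ⟨ht1, (lt_div_iff₀ hL0).2 (by linarith)⟩] with ω hω
    simp only [hG]
    rw [lintegral_finsetSum _ (fun i _ => by fun_prop), Finset.mul_sum]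
    refine Finset.sum_le_sum fun i _ => ?_
    have h1 : L * t * f i ((L * t) • (ω : EuclideanSpace ℝ (Fin 5)))
        - t * f i (t • (ω : EuclideanSpace ℝ (Fin 5))) =
        ∫ ρ in t..L * t, h i (ρ • (ω : EuclideanSpace ℝ (Fin 5))) := by
      have h2 := intervalIntegral.integral_comp_mul_left (a := 1) (b := L)
        (fun ρ => h i (ρ • (ω : EuclideanSpace ℝ (Fin 5)))) ht0.ne'
      have h3 := hω i
      simp only [smul_smul] at h3
      simp only [mul_comm t, one_mul] at h2
      rw [h2, smul_eq_mul] at h3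
      rw [← mul_inv_cancel_left₀ ht0.ne' (∫ ρ in t..L * t, _), ← h3]
      ring
    rw [h1]
    exact ofReal_sq_intervalIntegral_le (by fun_prop) ht2.le
  have hGm' : Measurable fun q : sphere (0 : EuclideanSpace ℝ (Fin 5)) 1 × ℝ =>
      G (q.2 • (q.1 : EuclideanSpace ℝ (Fin 5))) := by fun_prop
  refine (lintegral_mono_ae hω).trans ?_
  rw [lintegral_const_mul _ hGm'.lintegral_prod_right',
    lintegral_lintegral_swap hGm'.aemeasurable,
    hσ.lintegral_annulus hGm ht0.le ht2.le, setLIntegral_congr Ioo_ae_eq_Ioc.symm,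
    div_eq_mul_inv, ENNReal.ofReal_mul (by linarith), mul_assoc]
  gcongr
  rw [← lintegral_const_mul' _ _ ENNReal.ofReal_ne_top]
  refine setLIntegral_mono' measurableSet_Ioo fun ρ hρ => ?_
  rw [mul_comm, mul_assoc, ← ENNReal.ofReal_mul (by positivity)]
  refine le_mul_of_one_le_right' (ENNReal.one_le_ofReal.2 ?_)
  rw [← div_eq_mul_inv, one_le_div (by positivity)]
  exact pow_le_pow_left₀ hr.le (ht1.trans hρ.1).le 4

end Polar

section Connection

theorem frobenius_norm_sq {n : ℕ} (M : Matrix (Fin n) (Fin n) ℝ) :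
    ‖M‖ ^ 2 = ∑ a, ∑ b, M a b ^ 2 := by
  have h0 : 0 ≤ ∑ a, ∑ b, M a b ^ 2 :=
    Finset.sum_nonneg fun a _ => Finset.sum_nonneg fun b _ => sq_nonneg _
  have h := Matrix.frobenius_norm_def M
  simp only [Real.rpow_two, Real.norm_eq_abs, sq_abs] at h
  rw [h, ← Real.sqrt_eq_rpow, Real.sq_sqrt h0]

theorem memLp_two_matrix_entry {α : Type*} [MeasurableSpace α] {ν : Measure α} {n : ℕ}
    {M : α → Matrix (Fin n) (Fin n) ℝ} (hm : ∀ a b, Measurable fun x => M x a b)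
    (h : ∫⁻ x, ENNReal.ofReal (‖M x‖ ^ 2) ∂ν < ⊤) (a b : Fin n) :
    MemLp (fun x => M x a b) 2 ν := by
  rw [memLp_two_iff_integrable_sq (hm a b).aestronglyMeasurable]
  refine ⟨((hm a b).pow_const 2).aestronglyMeasurable, ?_⟩
  rw [hasFiniteIntegral_iff_ofReal (Eventually.of_forall fun x => sq_nonneg _)]
  refine (lintegral_mono fun x => ENNReal.ofReal_le_ofReal ?_).trans_lt h
  rw [frobenius_norm_sq]
  refine (Finset.single_le_sum (f := fun b => M x a b ^ 2) (fun b _ => sq_nonneg _)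
    (Finset.mem_univ b)).trans ?_
  exact Finset.single_le_sum (f := fun a => ∑ b, M x a b ^ 2)
    (fun a _ => Finset.sum_nonneg fun b _ => sq_nonneg _) (Finset.mem_univ a)

/-- The distributional curvature identity `F i j = ∂ i (A j) - ∂ j (A i) + [A i, A j]` on `U`,
stated entrywise. -/
def IsWeakCurvature {n : ℕ} (U : Set (EuclideanSpace ℝ (Fin 5)))
    (A : Fin 5 → EuclideanSpace ℝ (Fin 5) → Matrix (Fin n) (Fin n) ℝ)
    (F : Fin 5 → Fin 5 → EuclideanSpace ℝ (Fin 5) → Matrix (Fin n) (Fin n) ℝ) : Prop :=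
  ∀ (i j : Fin 5) (φ : EuclideanSpace ℝ (Fin 5) → ℝ), ContDiff ℝ (⊤ : ℕ∞) φ →
    HasCompactSupport φ → tsupport φ ⊆ U → ∀ a b : Fin n,
      (∫ x in U, F i j x a b * φ x) =
        -(∫ x in U, (A j x a b * fderiv ℝ φ x (EuclideanSpace.single i 1)
            - A i x a b * fderiv ℝ φ x (EuclideanSpace.single j 1)))
        + ∫ x in U, (A i x * A j x - A j x * A i x) a b * φ x

variable {n : ℕ} {U : Set (EuclideanSpace ℝ (Fin 5))}
  {A : Fin 5 → EuclideanSpace ℝ (Fin 5) → Matrix (Fin n) (Fin n) ℝ}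
  {F : Fin 5 → Fin 5 → EuclideanSpace ℝ (Fin 5) → Matrix (Fin n) (Fin n) ℝ}

theorem IsWeakCurvature.ae_antisymm (hw : IsWeakCurvature U A F) (hU : IsOpen U)
    (hF : ∀ i j a b, IntegrableOn (fun x => F i j x a b) U) (i j : Fin 5) (a b : Fin n) :
    ∀ᵐ x, x ∈ U → F i j x a b + F j i x a b = 0 := by
  have hi : IntegrableOn (fun x => F i j x a b + F j i x a b) U := (hF i j a b).add (hF j i a b)
  refine hU.ae_eq_zero_of_integral_contDiff_smul_eq_zero hi.locallyIntegrableOn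
    fun φ hφ hφc hφU => ?_
  obtain ⟨N, hN⟩ := hφ.continuous.bounded_above_of_compact_support hφc
  have hφm : AEStronglyMeasurable φ (volume.restrict U) := hφ.continuous.aestronglyMeasurable
  have hInt : ∀ i j, IntegrableOn (fun x => F i j x a b * φ x) U := fun i j =>
    (hF i j a b).mul_bdd hφm (Eventually.of_forall hN)
  have e : ∫ x in U, F i j x a b * φ x + F j i x a b * φ x =
      ∫ x, φ x • (F i j x a b + F j i x a b) := by
    rw [← integral_indicator hU.measurableSet]
    refine integral_congr_ae (Eventually.of_forall fun x => ?_)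
    by_cases hx : x ∈ U
    · simp only [indicator_of_mem hx, smul_eq_mul]
      ring
    · have : φ x = 0 := image_eq_zero_of_notMem_tsupport fun hc => hx (hφU hc)
      simp [indicator_of_notMem hx, this]
  rw [← e, integral_add (hInt i j) (hInt j i), hw i j φ hφ hφc hφU, hw j i φ hφ hφc hφU]
  have e1 : ∫ x in U, (A i x a b * fderiv ℝ φ x (EuclideanSpace.single j 1)
            - A j x a b * fderiv ℝ φ x (EuclideanSpace.single i 1)) =
      -∫ x in U, (A j x a b * fderiv ℝ φ x (EuclideanSpace.single i 1)
            - A i x a b * fderiv ℝ φ x (EuclideanSpace.single j 1)) := by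
    rw [← integral_neg]
    simp only [neg_sub]
  have e2 : ∫ x in U, (A j x * A i x - A i x * A j x) a b * φ x =
      -∫ x in U, (A i x * A j x - A j x * A i x) a b * φ x := by
    rw [← integral_neg]
    simp only [← neg_mul, ← Matrix.neg_apply, neg_sub]
  rw [e1, e2]
  ring

theorem IsWeakCurvature.radial (hw : IsWeakCurvature U A F)
    (hA : ∀ k a b, MemLp (fun x => A k x a b) 2 (volume.restrict U))
    (hA1 : ∀ k a b, IntegrableOn (fun x => A k x a b) U)
    (hF : ∀ i j a b, IntegrableOn (fun x => F i j x a b) U)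
    (hrad : ∀ᵐ x ∂(volume.restrict U), ∑ k, x k • A k x = 0) (k : Fin 5) (a b : Fin n)
    {φ : EuclideanSpace ℝ (Fin 5) → ℝ} (hφ : ContDiff ℝ (⊤ : ℕ∞) φ) (hφc : HasCompactSupport φ)
    (hφU : tsupport φ ⊆ U) :
    ∫ x in U, (∑ i, x i * F i k x a b) * φ x =
      -∫ x in U, A k x a b * (4 * φ x + fderiv ℝ φ x x) := by
  have hcoord : ∀ i : Fin 5, ContDiff ℝ (⊤ : ℕ∞) fun x : EuclideanSpace ℝ (Fin 5) => x i :=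
    fun i => (EuclideanSpace.proj (𝕜 := ℝ) i).contDiff
  set Φ : Fin 5 → EuclideanSpace ℝ (Fin 5) → ℝ := fun i x => x i * φ x with hΦ
  have hΦs : ∀ i, ContDiff ℝ (⊤ : ℕ∞) (Φ i) := fun i => (hcoord i).mul hφ
  have hΦc : ∀ i, HasCompactSupport (Φ i) := fun i => hφc.mul_left
  have hΦU : ∀ i, tsupport (Φ i) ⊆ U := fun i => (tsupport_mul_subset_right).trans hφU
  have hd : ∀ i x v, fderiv ℝ (Φ i) x v = v i * φ x + x i * fderiv ℝ φ x v := by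
    intro i x v
    have h1 := ((EuclideanSpace.proj (𝕜 := ℝ) i).hasFDerivAt (x := x)).mul
      ((hφ.differentiable (by simp)) x).hasFDerivAt
    have h2 := h1.fderiv
    change fderiv ℝ (Φ i) x = _ at h2
    rw [h2]
    simp
    ring
  have bdd_mul : ∀ {g ψ : EuclideanSpace ℝ (Fin 5) → ℝ}, IntegrableOn g U → Continuous ψ →
      HasCompactSupport ψ → IntegrableOn (fun x => g x * ψ x) U := by
    intro g ψ hg hψ hψc
    obtain ⟨N, hN⟩ := hψ.bounded_above_of_compact_support hψc
    exact hg.mul_bdd hψ.aestronglyMeasurable (Eventually.of_forall hN)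
  have hdΦ : ∀ i v, Continuous (fun x => fderiv ℝ (Φ i) x v) := fun i v =>
    ((hΦs i).continuous_fderiv (by simp)).clm_apply continuous_const
  have hdΦc : ∀ i v, HasCompactSupport (fun x => fderiv ℝ (Φ i) x v) := fun i v =>
    (hΦc i).fderiv_apply (𝕜 := ℝ) v
  have hcomm : ∀ i, IntegrableOn (fun x => (A i x * A k x - A k x * A i x) a b) U := by
    intro i
    simp only [Matrix.sub_apply, Matrix.mul_apply]
    exact (integrable_finsetSum _ fun c _ => (hA i a c).integrable_mul (hA k c b)).sub
      (integrable_finsetSum _ fun c _ => (hA k a c).integrable_mul (hA i c b))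
  have hT1 : ∀ i, IntegrableOn (fun x =>
      A k x a b * fderiv ℝ (Φ i) x (EuclideanSpace.single i 1)
        - A i x a b * fderiv ℝ (Φ i) x (EuclideanSpace.single k 1)) U := fun i =>
    (bdd_mul (hA1 k a b) (hdΦ i _) (hdΦc i _)).sub (bdd_mul (hA1 i a b) (hdΦ i _) (hdΦc i _))
  have hT2 : ∀ i, IntegrableOn (fun x => (A i x * A k x - A k x * A i x) a b * Φ i x) U :=
    fun i => bdd_mul (hcomm i) (hΦs i).continuous (hΦc i)
  calc ∫ x in U, (∑ i, x i * F i k x a b) * φ x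
      = ∑ i, ∫ x in U, F i k x a b * Φ i x := by
        rw [← integral_finsetSum _ fun i _ => bdd_mul (hF i k a b) (hΦs i).continuous (hΦc i)]
        refine integral_congr_ae (Eventually.of_forall fun x => ?_)
        simp only [Finset.sum_mul, hΦ]
        exact Finset.sum_congr rfl fun i _ => by ring
    _ = -(∫ x in U, ∑ i, (A k x a b * fderiv ℝ (Φ i) x (EuclideanSpace.single i 1)
            - A i x a b * fderiv ℝ (Φ i) x (EuclideanSpace.single k 1)))
          + ∫ x in U, ∑ i, (A i x * A k x - A k x * A i x) a b * Φ i x := by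
        rw [integral_finsetSum _ fun i _ => hT1 i, integral_finsetSum _ fun i _ => hT2 i,
          ← Finset.sum_neg_distrib, ← Finset.sum_add_distrib]
        exact Finset.sum_congr rfl fun i _ => hw i k _ (hΦs i) (hΦc i) (hΦU i) a b
    _ = -(∫ x in U, A k x a b * (4 * φ x + fderiv ℝ φ x x)) + ∫ _ in U, (0 : ℝ) := by
        congr 1
        · congr 1
          refine integral_congr_ae ?_
          filter_upwards [hrad] with x hx
          have hx' : ∑ i, x i * A i x a b = 0 := by
            have := congrFun (congrFun hx a) b
            simpa [Matrix.sum_apply] using this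
          have hdx : fderiv ℝ φ x x = ∑ i, x i * fderiv ℝ φ x (EuclideanSpace.single i 1) := by
            have hs : x = ∑ i, x i • EuclideanSpace.single i (1 : ℝ) := by
              ext j
              simp [Finset.sum_apply, Pi.single_apply]
            refine (congrArg (fderiv ℝ φ x) hs).trans ?_
            simp only [map_sum, map_smul, smul_eq_mul]
          have s1 : ∑ i : Fin 5, A k x a b * ((EuclideanSpace.single i (1 : ℝ)) i * φ x) =
              5 * (A k x a b * φ x) := by simp
          have s2 : ∑ i : Fin 5, A i x a b * ((EuclideanSpace.single k (1 : ℝ)) i * φ x) =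
              A k x a b * φ x := by simp
          have s3 : ∑ i : Fin 5, A i x a b *
              (x i * fderiv ℝ φ x (EuclideanSpace.single k 1)) = 0 := by
            rw [← zero_mul (fderiv ℝ φ x (EuclideanSpace.single k 1)), ← hx', Finset.sum_mul]
            exact Finset.sum_congr rfl fun i _ => by ring
          simp only [hd, hdx, mul_add, Finset.sum_sub_distrib, Finset.sum_add_distrib, s1, s2, s3]
          rw [Finset.mul_sum]
          ring
        · refine integral_congr_ae ?_
          filter_upwards [hrad] with x hx
          have h1 : (∑ i, x i • A i x) * A k x - A k x * (∑ i, x i • A i x) = 0 := by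
            rw [hx]; simp
          simp only [Finset.sum_mul, Finset.mul_sum, smul_mul_assoc, mul_smul_comm,
            ← Finset.sum_sub_distrib, ← smul_sub] at h1
          have h2 := congrFun (congrFun h1 a) b
          simp only [Matrix.sum_apply, Matrix.smul_apply, smul_eq_mul, Matrix.zero_apply] at h2
          rw [← zero_mul (φ x), ← h2, Finset.sum_mul]
          exact Finset.sum_congr rfl fun i _ => by ring
    _ = _ := by simp

end Connection

theorem ofReal_frobenius_norm_sq {n : ℕ} (M : Matrix (Fin n) (Fin n) ℝ) :
    ENNReal.ofReal (‖M‖ ^ 2) = ∑ q : Fin n × Fin n, ENNReal.ofReal (M q.1 q.2 ^ 2) := by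
  rw [frobenius_norm_sq, ← Fintype.sum_prod_type',
    ENNReal.ofReal_sum_of_nonneg fun q _ => sq_nonneg _]

theorem sum_ofReal_radial_sq_le {n : ℕ} (x : EuclideanSpace ℝ (Fin 5))
    (F : Fin 5 → Fin 5 → Matrix (Fin n) (Fin n) ℝ)
    (hF : ∀ i j a b, F i j a b + F j i a b = 0) :
    ∑ q : Fin 5 × Fin n × Fin n, ENNReal.ofReal ((∑ i, x i * F i q.1 q.2.1 q.2.2) ^ 2) ≤
      ENNReal.ofReal (2 * ‖x‖ ^ 2) * ∑ i : Fin 5, ∑ j : Fin 5,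
        if i < j then ENNReal.ofReal (‖F i j‖ ^ 2) else 0 := by
  have hsym : ∀ i j, ‖F i j‖ ^ 2 = ‖F j i‖ ^ 2 := by
    intro i j
    simp only [frobenius_norm_sq]
    refine Finset.sum_congr rfl fun a _ => Finset.sum_congr rfl fun b _ => ?_
    rw [eq_neg_of_add_eq_zero_left (hF i j a b), neg_sq]
  have hdiag : ∀ i, ‖F i i‖ ^ 2 = 0 := by
    intro i
    simp only [frobenius_norm_sq]
    refine Finset.sum_eq_zero fun a _ => Finset.sum_eq_zero fun b _ => ?_
    have : F i i a b = 0 := by linarith [hF i i a b]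
    rw [this, sq, zero_mul]
  have hR : ∑ i : Fin 5, ∑ j : Fin 5, (if i < j then ENNReal.ofReal (‖F i j‖ ^ 2) else 0) =
      ENNReal.ofReal (∑ i : Fin 5, ∑ j : Fin 5, if i < j then ‖F i j‖ ^ 2 else 0) := by
    have h0 : ∀ i j : Fin 5, 0 ≤ if i < j then ‖F i j‖ ^ 2 else 0 := fun i j => by
      split_ifs <;> positivity
    rw [ENNReal.ofReal_sum_of_nonneg fun i _ => Finset.sum_nonneg fun j _ => h0 i j]
    refine Finset.sum_congr rfl fun i _ => ?_
    rw [ENNReal.ofReal_sum_of_nonneg fun j _ => h0 i j]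
    refine Finset.sum_congr rfl fun j _ => ?_
    split_ifs <;> simp
  rw [hR, ← ENNReal.ofReal_mul (by positivity),
    ← ENNReal.ofReal_sum_of_nonneg fun q _ => sq_nonneg _]
  refine ENNReal.ofReal_le_ofReal ?_
  have hhalf : ∑ k : Fin 5, ∑ i : Fin 5, ‖F i k‖ ^ 2 =
      2 * ∑ i : Fin 5, ∑ j : Fin 5, if i < j then ‖F i j‖ ^ 2 else 0 := by
    simp only [Fin.sum_univ_five, hdiag, hsym 1 0, hsym 2 0, hsym 3 0, hsym 4 0, hsym 2 1,
      hsym 3 1, hsym 4 1, hsym 3 2, hsym 4 2, hsym 4 3]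
    simp
    ring
  calc ∑ q : Fin 5 × Fin n × Fin n, (∑ i, x i * F i q.1 q.2.1 q.2.2) ^ 2
      ≤ ∑ q : Fin 5 × Fin n × Fin n, ‖x‖ ^ 2 * ∑ i, F i q.1 q.2.1 q.2.2 ^ 2 := by
        refine Finset.sum_le_sum fun q _ => ?_
        rw [EuclideanSpace.real_norm_sq_eq]
        exact Finset.sum_mul_sq_le_sq_mul_sq _ _ _
    _ = ‖x‖ ^ 2 * ∑ k : Fin 5, ∑ i : Fin 5, ‖F i k‖ ^ 2 := by
        rw [← Finset.mul_sum, Fintype.sum_prod_type]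
        congr 1
        refine Finset.sum_congr rfl fun k _ => ?_
        rw [Finset.sum_comm]
        refine Finset.sum_congr rfl fun i _ => ?_
        rw [frobenius_norm_sq, ← Fintype.sum_prod_type']
    _ = _ := by rw [hhalf]; ring

/-- Lemma 2.3 of the paper (slice oscillation estimate, in the radial gauge): for an `L²`
matrix-valued connection form `A` on the annulus `{r < |x| < 2r} ⊂ ℝ⁵` with `L²`
distributional curvature `F` and vanishing radial component, the pulled-back slices
`Ã(ρ)(ω) = ρ • (A₁(ρω), …, A₅(ρω))` satisfy a `1/2`-Hölder estimate in `L²(S⁴)`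
controlled by the curvature energy of the corresponding annulus. -/
theorem slice_oscillation (σ : Measure (Metric.sphere (0 : EuclideanSpace ℝ (Fin 5)) 1))
    (hσ : IsPolarMeasure σ) :
    ∃ C : ℝ, 0 < C ∧
      ∀ (n : ℕ), 1 ≤ n →
      ∀ (r : ℝ), 0 < r →
      ∀ (A : Fin 5 → EuclideanSpace ℝ (Fin 5) → Matrix (Fin n) (Fin n) ℝ)
        (F : Fin 5 → Fin 5 → EuclideanSpace ℝ (Fin 5) → Matrix (Fin n) (Fin n) ℝ),
      (∀ (k : Fin 5) (a b : Fin n), Measurable (fun x => A k x a b)) →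
      (∀ k : Fin 5, (∫⁻ x in {x : EuclideanSpace ℝ (Fin 5) | r < ‖x‖ ∧ ‖x‖ < 2*r},
          ENNReal.ofReal (‖A k x‖ ^ 2)) < ⊤) →
      (∀ (i j : Fin 5) (a b : Fin n), Measurable (fun x => F i j x a b)) →
      (∀ i j : Fin 5, (∫⁻ x in {x : EuclideanSpace ℝ (Fin 5) | r < ‖x‖ ∧ ‖x‖ < 2*r},
          ENNReal.ofReal (‖F i j x‖ ^ 2)) < ⊤) →
      -- distributional curvature identity, entrywise
      (∀ (i j : Fin 5) (φ : EuclideanSpace ℝ (Fin 5) → ℝ), ContDiff ℝ (⊤ : ℕ∞) φ →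
        HasCompactSupport φ →
        tsupport φ ⊆ {x : EuclideanSpace ℝ (Fin 5) | r < ‖x‖ ∧ ‖x‖ < 2*r} →
        ∀ a b : Fin n,
          (∫ x in {x : EuclideanSpace ℝ (Fin 5) | r < ‖x‖ ∧ ‖x‖ < 2*r}, F i j x a b * φ x) =
            -(∫ x in {x : EuclideanSpace ℝ (Fin 5) | r < ‖x‖ ∧ ‖x‖ < 2*r},
                (A j x a b * fderiv ℝ φ x (EuclideanSpace.single i 1)
                  - A i x a b * fderiv ℝ φ x (EuclideanSpace.single j 1)))
            + ∫ x in {x : EuclideanSpace ℝ (Fin 5) | r < ‖x‖ ∧ ‖x‖ < 2*r},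
                (A i x * A j x - A j x * A i x) a b * φ x) →
      -- the connection has no radial component
      (∀ᵐ x ∂(volume.restrict {x : EuclideanSpace ℝ (Fin 5) | r < ‖x‖ ∧ ‖x‖ < 2*r}),
        ∑ k : Fin 5, x k • A k x = (0 : Matrix (Fin n) (Fin n) ℝ)) →
      -- conclusion: for a.e. pair (t, t') with r < t' < t < 2r
      ∀ᵐ p : ℝ × ℝ ∂(volume : Measure (ℝ × ℝ)),
        r < p.2 → p.2 < p.1 → p.1 < 2*r →
          (∫⁻ ω, ∑ k : Fin 5, ENNReal.ofReal
              (‖p.1 • A k (p.1 • (ω : EuclideanSpace ℝ (Fin 5)))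
                - p.2 • A k (p.2 • (ω : EuclideanSpace ℝ (Fin 5)))‖ ^ 2) ∂σ)
            ≤ ENNReal.ofReal (C * |p.1 - p.2| / r ^ 2) *
              ∫⁻ x in {x : EuclideanSpace ℝ (Fin 5) | p.2 < ‖x‖ ∧ ‖x‖ < p.1},
                ∑ i : Fin 5, ∑ j : Fin 5,
                  if i < j then ENNReal.ofReal (‖F i j x‖ ^ 2) else 0 := by
  refine ⟨8, by norm_num, ?_⟩
  intro n _ r hr A F hAm hA2 hFm hF2 hcurv hrad
  set U : Set (EuclideanSpace ℝ (Fin 5)) := {x | r < ‖x‖ ∧ ‖x‖ < 2 * r} with hUdef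
  have hUo : IsOpen U :=
    (isOpen_lt continuous_const continuous_norm).inter (isOpen_lt continuous_norm continuous_const)
  have hUfin : IsFiniteMeasure (volume.restrict U) := by
    refine isFiniteMeasure_restrict.2 (ne_of_lt ?_)
    exact (measure_mono fun x hx => mem_ball_zero_iff.2 hx.2).trans_lt
      (measure_ball_lt_top (x := (0 : EuclideanSpace ℝ (Fin 5))) (r := 2 * r))
  have hAL2 : ∀ k a b, MemLp (fun x => A k x a b) 2 (volume.restrict U) :=
    fun k => memLp_two_matrix_entry (hAm k) (hA2 k)
  have hAL1 : ∀ k a b, IntegrableOn (fun x => A k x a b) U :=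
    fun k a b => (hAL2 k a b).integrable one_le_two
  have hFL1 : ∀ i j a b, IntegrableOn (fun x => F i j x a b) U :=
    fun i j a b => (memLp_two_matrix_entry (hFm i j) (hF2 i j) a b).integrable one_le_two
  have hw : IsWeakCurvature U A F := hcurv
  set f : Fin 5 × Fin n × Fin n → EuclideanSpace ℝ (Fin 5) → ℝ :=
    fun q x => A q.1 x q.2.1 q.2.2 with hf
  set h : Fin 5 × Fin n × Fin n → EuclideanSpace ℝ (Fin 5) → ℝ :=
    fun q x => ∑ i, x i * F i q.1 x q.2.1 q.2.2 with hh
  have hhm : ∀ q, Measurable (h q) := fun q =>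
    Finset.measurable_sum _ fun i _ => Measurable.mul (by fun_prop) (hFm i _ _ _)
  have hhi : ∀ q, IntegrableOn (h q) U := by
    intro q
    refine integrable_finsetSum _ fun i _ => ?_
    refine (hFL1 i q.1 q.2.1 q.2.2).bdd_mul (c := 2 * r)
      (Measurable.aestronglyMeasurable (by fun_prop)) ?_
    filter_upwards [ae_restrict_mem hUo.measurableSet] with x hx
    exact (PiLp.norm_apply_le x i).trans hx.2.le
  have hslice := hσ.ae_lintegral_slice_sub_le (f := f) (h := h) (fun q => hAm _ _ _) hhm
    (R := 2 * r) hr fun L hL => by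
      have hL0 : 0 < L := zero_lt_one.trans hL
      have hVo : IsOpen {x : EuclideanSpace ℝ (Fin 5) | r < ‖x‖ ∧ ‖x‖ < 2 * r / L} :=
        (isOpen_lt continuous_const continuous_norm).inter
          (isOpen_lt continuous_norm continuous_const)
      have hq : ∀ q, ∀ᵐ x, x ∈ {x : EuclideanSpace ℝ (Fin 5) | r < ‖x‖ ∧ ‖x‖ < 2 * r / L} →
          L * f q (L • x) - f q x = ∫ s in (1 : ℝ)..L, h q (s • x) := fun q => by
        refine ae_dilation_sub_eq_intervalIntegral hUo.measurableSet hVo (hAL1 _ _ _) (hhm q)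
          (hhi q) hL.le (fun x hx s hs => ?_) fun φ hφ hφc hφU => ?_
        · have hs0 : 0 < s := zero_lt_one.trans_le hs.1
          have h1 := (lt_div_iff₀ hL0).1 hx.2
          refine ⟨?_, ?_⟩ <;> rw [norm_smul, Real.norm_of_nonneg hs0.le]
          · exact hx.1.trans_le (le_mul_of_one_le_left (norm_nonneg x) hs.1)
          · calc s * ‖x‖ ≤ L * ‖x‖ := mul_le_mul_of_nonneg_right hs.2 (norm_nonneg x)
              _ < 2 * r := by linarith
        · rw [hw.radial hAL2 hAL1 hFL1 hrad q.1 q.2.1 q.2.2 hφ hφc hφU]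
          norm_num
      filter_upwards [ae_all_iff.2 hq] with x hx hxV q using hx q hxV
  have hG : ∀ᵐ x, x ∈ U → ∑ q, ENNReal.ofReal (h q x ^ 2) ≤
      ENNReal.ofReal (8 * r ^ 2) * ∑ i : Fin 5, ∑ j : Fin 5,
        if i < j then ENNReal.ofReal (‖F i j x‖ ^ 2) else 0 := by
    have hanti : ∀ᵐ x, ∀ i j a b, x ∈ U → F i j x a b + F j i x a b = 0 := by
      simp only [ae_all_iff]
      exact fun i j a b => hw.ae_antisymm hUo hFL1 i j a b
    filter_upwards [hanti] with x hx hxU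
    refine (sum_ofReal_radial_sq_le x (fun i j => F i j x)
      fun i j a b => hx i j a b hxU).trans ?_
    have hle : 2 * ‖x‖ ^ 2 ≤ 8 * r ^ 2 := by nlinarith [hxU.2, norm_nonneg x]
    gcongr ENNReal.ofReal ?_ * _
  filter_upwards [hslice] with p hp h1 h2 h3
  have hL : ∀ ω : sphere (0 : EuclideanSpace ℝ (Fin 5)) 1, ∑ k : Fin 5, ENNReal.ofReal
      (‖p.1 • A k (p.1 • (ω : EuclideanSpace ℝ (Fin 5)))
        - p.2 • A k (p.2 • (ω : EuclideanSpace ℝ (Fin 5)))‖ ^ 2) =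
      ∑ q, ENNReal.ofReal ((p.1 * f q (p.1 • (ω : EuclideanSpace ℝ (Fin 5)))
          - p.2 * f q (p.2 • (ω : EuclideanSpace ℝ (Fin 5)))) ^ 2) := by
    intro ω
    rw [Fintype.sum_prod_type]
    refine Finset.sum_congr rfl fun k _ => ?_
    rw [ofReal_frobenius_norm_sq]
    rfl
  simp only [hL]
  refine (hp h1 h2 h3).trans ?_
  have hsub : {x : EuclideanSpace ℝ (Fin 5) | p.2 < ‖x‖ ∧ ‖x‖ < p.1} ⊆ U :=
    fun x hx => ⟨h1.trans hx.1, hx.2.trans h3⟩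
  have hmono : ∫⁻ x in {x : EuclideanSpace ℝ (Fin 5) | p.2 < ‖x‖ ∧ ‖x‖ < p.1},
      ∑ q, ENNReal.ofReal (h q x ^ 2) ≤
      ENNReal.ofReal (8 * r ^ 2) *
        ∫⁻ x in {x : EuclideanSpace ℝ (Fin 5) | p.2 < ‖x‖ ∧ ‖x‖ < p.1},
          ∑ i : Fin 5, ∑ j : Fin 5, if i < j then ENNReal.ofReal (‖F i j x‖ ^ 2) else 0 := by
    rw [← lintegral_const_mul' _ _ ENNReal.ofReal_ne_top]
    refine lintegral_mono_ae ?_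
    filter_upwards [ae_restrict_of_ae hG, ae_restrict_mem (measurableSet_annulus p.2 p.1)]
      with x hx hxm using hx (hsub hxm)
  have hc : ENNReal.ofReal (8 * |p.1 - p.2| / r ^ 2) =
      ENNReal.ofReal ((p.1 - p.2) / r ^ 4) * ENNReal.ofReal (8 * r ^ 2) := by
    rw [← ENNReal.ofReal_mul (div_nonneg (by linarith) (by positivity)),
      abs_of_pos (sub_pos.2 h2)]
    congr 1
    field_simp
  rw [hc, mul_assoc]
  gcongr
end

section
/- Let F : ℝ⁵ → E be measurable with ∫_{ℝ⁵}‖F‖² < ∞, and fix α ∈ (1,2) and N ∈ ℕ. Then for every ε > 0 there exists r₀ > 0 such that for every r ∈ (0, r₀) and every finite family of points x_1, …, x_m ∈ ℝ⁵ with the property that every point of ℝ⁵ belongs to at most N of the closed balls B̄(x_i, αr), one has Σ_{i=1}^m ∫_{B(x_i, αr)} ‖F(y) − F̄_i‖² dy ≤ ε, where F̄_i := (1/|B(x_i, αr)|)∫_{B(x_i, αr)} F is the average of F over B(x_i, αr). -/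
open MeasureTheory Metric Set Filter

/-- The `L²` distance of `f` to its mean is at most twice its `L²` distance to any constant. -/
theorem lintegral_enorm_sub_integral_sq_le {Ω E : Type*} [MeasurableSpace Ω]
    [NormedAddCommGroup E] [NormedSpace ℝ E] [CompleteSpace E] {ν : Measure Ω}
    [IsProbabilityMeasure ν] {f : Ω → E} (hf : Integrable f ν) (c : E) :
    ∫⁻ y, ‖f y - ∫ z, f z ∂ν‖ₑ ^ 2 ∂ν ≤ 4 * ∫⁻ y, ‖f y - c‖ₑ ^ 2 ∂ν := by
  have hfc : Integrable (fun y => f y - c) ν := hf.sub (integrable_const c)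
  have sq_eq (h : Ω → E) : ∫⁻ y, ‖h y‖ₑ ^ 2 ∂ν = eLpNorm h 2 ν ^ 2 := by
    simpa using (eLpNorm_nnreal_pow_eq_lintegral (f := h) (μ := ν) (p := 2) two_ne_zero).symm
  have hmean : ‖c - ∫ z, f z ∂ν‖ₑ ≤ eLpNorm (fun y => f y - c) 2 ν := by
    have h : ∫ y, (f y - c) ∂ν = (∫ z, f z ∂ν) - c := by
      rw [integral_sub hf (integrable_const c)]
      simp
    rw [← enorm_neg, neg_sub, ← h]
    refine (enorm_integral_le_lintegral_enorm _).trans ?_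
    rw [← eLpNorm_one_eq_lintegral_enorm]
    exact eLpNorm_le_eLpNorm_of_exponent_le one_le_two hfc.aestronglyMeasurable
  have hdist : eLpNorm (fun y => f y - ∫ z, f z ∂ν) 2 ν
      ≤ 2 * eLpNorm (fun y => f y - c) 2 ν := by
    have h : (fun y => f y - ∫ z, f z ∂ν)
        = (fun y => f y - c) + fun _ => c - ∫ z, f z ∂ν := by
      ext y
      simp
    rw [h, two_mul]
    refine (eLpNorm_add_le hfc.aestronglyMeasurable aestronglyMeasurable_const
      one_le_two).trans ?_
    gcongr
    rw [eLpNorm_const _ two_ne_zero (IsProbabilityMeasure.ne_zero ν)]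
    simpa using hmean
  rw [sq_eq, sq_eq]
  calc _ ≤ (2 * eLpNorm (fun y => f y - c) 2 ν) ^ 2 := by gcongr
    _ = _ := by rw [mul_pow]; norm_num

theorem lintegral_enorm_sub_average_sq_le {Ω E : Type*} [MeasurableSpace Ω]
    [NormedAddCommGroup E] [NormedSpace ℝ E] [CompleteSpace E] {μ : Measure Ω}
    [IsFiniteMeasure μ] {f : Ω → E} (hf : Integrable f μ) (c : E) :
    ∫⁻ y, ‖f y - ⨍ z, f z ∂μ‖ₑ ^ 2 ∂μ ≤ 4 * ∫⁻ y, ‖f y - c‖ₑ ^ 2 ∂μ := by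
  rcases eq_or_ne μ 0 with rfl | hμ
  · simp
  have : NeZero μ := ⟨hμ⟩
  have h := lintegral_enorm_sub_integral_sq_le hf.to_average c
  rw [lintegral_smul_measure, lintegral_smul_measure, smul_eq_mul, smul_eq_mul,
    mul_left_comm] at h
  exact (ENNReal.mul_le_mul_iff_right (by simp) (by simpa using hμ)).1 h

/-- Integrals over sets with overlap at most `N` add up to at most `N` times the full integral. -/
theorem sum_setLIntegral_le_of_ncard_le {Ω ι : Type*} [MeasurableSpace Ω] [Fintype ι]
    {μ : Measure Ω} {s : ι → Set Ω} (hs : ∀ i, MeasurableSet (s i)) {N : ℕ}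
    (hN : ∀ y, {i | y ∈ s i}.ncard ≤ N) {f : Ω → ENNReal} (hf : AEMeasurable f μ) :
    ∑ i, ∫⁻ y in s i, f y ∂μ ≤ N * ∫⁻ y, f y ∂μ := by
  classical
  simp_rw [← lintegral_indicator (hs _)]
  rw [← lintegral_finsetSum' _ fun i _ => hf.indicator (hs i),
    ← lintegral_const_mul' _ _ (ENNReal.natCast_ne_top N)]
  refine lintegral_mono fun y => ?_
  have h := hN y
  rw [Set.ncard_eq_toFinset_card', Set.toFinset_ofPred] at h
  simp only [Set.indicator_apply, ← Finset.sum_filter, Finset.sum_const, nsmul_eq_mul]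
  gcongr

/-- An `L²` function is locally uniformly `L²`-close to constants, up to an error of small total
mass which does not depend on the location. -/
theorem exists_lintegral_le_and_enorm_sub_sq_le {X E : Type*} [MetricSpace X] [ProperSpace X]
    [MeasurableSpace X] [BorelSpace X] [NormedAddCommGroup E] [NormedSpace ℝ E]
    {μ : Measure X} [μ.Regular] {F : X → E} (hF : MemLp F 2 μ)
    {δ : ENNReal} (hδ : δ ≠ 0) :
    ∃ (g : X → E) (H : X → ENNReal) (ρ : ℝ), 0 < ρ ∧ AEMeasurable H μ ∧ ∫⁻ y, H y ∂μ ≤ δ ∧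
      ∀ x y, dist y x < ρ → ‖F y - g x‖ₑ ^ 2 ≤ H y := by
  obtain ⟨a, ha, haδ⟩ := ENNReal.exists_nnreal_pos_mul_lt (a := 4) (by simp) hδ
  obtain ⟨g, hgs, hFg, hg, hgL⟩ := hF.exists_hasCompactSupport_eLpNorm_sub_le (by simp)
    (ε := (NNReal.sqrt a : ENNReal)) (by simpa using ha.ne')
  set K := cthickening 1 (tsupport g)
  obtain ⟨b, hb, hbδ⟩ := ENNReal.exists_nnreal_pos_mul_lt (a := 4 * μ K) (b := δ)
    (ENNReal.mul_ne_top (by simp) hgs.isCompact.cthickening.measure_lt_top.ne) hδ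
  have hKm : MeasurableSet K := isClosed_cthickening.measurableSet
  obtain ⟨ρ, hρ, hgρ⟩ := Metric.uniformContinuous_iff.1
    (hgs.uniformContinuous_of_continuous hg) (NNReal.sqrt b) (by simpa using hb)
  have hd : AEMeasurable (fun y => 2 * ‖F y - g y‖ₑ ^ 2) μ :=
    ((hF.sub hgL).aestronglyMeasurable.enorm.pow_const 2).const_mul 2
  refine ⟨g, fun y => 2 * ‖F y - g y‖ₑ ^ 2 + K.indicator (fun _ => 2 * (b : ENNReal)) y, min ρ 1,
    by positivity, hd.add (measurable_const.indicator hKm).aemeasurable, ?_, fun x y hxy => ?_⟩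
  · rw [lintegral_add_left' hd, lintegral_const_mul' _ _ (by simp), lintegral_indicator_const hKm]
    have h : ∫⁻ y, ‖F y - g y‖ₑ ^ 2 ∂μ = eLpNorm (F - g) 2 μ ^ 2 := by
      simpa using
        (eLpNorm_nnreal_pow_eq_lintegral (f := F - g) (μ := μ) (p := 2) two_ne_zero).symm
    have h₁ : ∫⁻ y, ‖F y - g y‖ₑ ^ 2 ∂μ ≤ a := by
      rw [h]
      calc _ ≤ (NNReal.sqrt a : ENNReal) ^ 2 := by gcongr
        _ = a := by rw [← ENNReal.coe_pow, NNReal.sq_sqrt]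
    refine (ENNReal.mul_le_mul_iff_right two_ne_zero (by simp)).1 ?_
    calc _ ≤ 2 * (2 * (a : ENNReal) + 2 * b * μ K) := by gcongr
      _ = a * 4 + b * (4 * μ K) := by ring
      _ ≤ δ + δ := add_le_add haδ.le hbδ.le
      _ = 2 * δ := (two_mul δ).symm
  · have hosc : ‖g y - g x‖ₑ ^ 2 ≤ K.indicator (fun _ => (b : ENNReal)) y := by
      by_cases hy : y ∈ K
      · rw [Set.indicator_of_mem hy]
        have h : ‖g y - g x‖ₑ ≤ NNReal.sqrt b := by
          rw [← ofReal_norm, ← dist_eq_norm, ← ENNReal.ofReal_coe_nnreal]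
          exact ENNReal.ofReal_le_ofReal (hgρ (hxy.trans_le (min_le_left _ _))).le
        calc _ ≤ (NNReal.sqrt b : ENNReal) ^ 2 := by gcongr
          _ = b := by rw [← ENNReal.coe_pow, NNReal.sq_sqrt]
      · have hgy : g y = 0 := image_eq_zero_of_notMem_tsupport fun h =>
          hy (self_subset_cthickening _ h)
        have hgx : g x = 0 := image_eq_zero_of_notMem_tsupport fun h =>
          hy (mem_cthickening_of_dist_le _ _ _ _ h (hxy.trans_le (min_le_right _ _)).le)
        simp [hgx, hgy]
    calc ‖F y - g x‖ₑ ^ 2 ≤ (‖F y - g y‖ₑ + ‖g y - g x‖ₑ) ^ 2 := by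
          gcongr
          rw [← sub_add_sub_cancel (F y) (g y) (g x)]
          exact enorm_add_le _ _
      _ ≤ 2 * (‖F y - g y‖ₑ ^ 2 + ‖g y - g x‖ₑ ^ 2) := by
          have h := ENNReal.rpow_add_le_mul_rpow_add_rpow ‖F y - g y‖ₑ ‖g y - g x‖ₑ one_le_two
          norm_num at h
          exact h
      _ ≤ 2 * (‖F y - g y‖ₑ ^ 2 + K.indicator (fun _ => (b : ENNReal)) y) := by gcongr
      _ = _ := by
          by_cases hy : y ∈ K <;> simp [hy, mul_add]

/-- Step 5 of the proof of Theorem 4.8 of the paper: uniform vanishing, as the scale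
`r → 0`, of the summed mean oscillation of an `L²` function over fine grids of balls with
bounded overlap. -/
theorem summed_mean_oscillation_vanishes {E : Type*} [NormedAddCommGroup E]
    [NormedSpace ℝ E] [FiniteDimensional ℝ E] [MeasurableSpace E] [BorelSpace E]
    (α : ℝ) (hα1 : 1 < α) (hα2 : α < 2) (N : ℕ)
    (F : EuclideanSpace ℝ (Fin 5) → E) (hFm : Measurable F)
    (hF : (∫⁻ y, ENNReal.ofReal (‖F y‖ ^ 2)) < ⊤) :
    ∀ ε : ℝ, 0 < ε → ∃ r₀ : ℝ, 0 < r₀ ∧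
      ∀ r : ℝ, 0 < r → r < r₀ →
      ∀ (m : ℕ) (x : Fin m → EuclideanSpace ℝ (Fin 5)),
        (∀ y : EuclideanSpace ℝ (Fin 5),
          ({i : Fin m | y ∈ Metric.closedBall (x i) (α * r)}).ncard ≤ N) →
        ∑ i, (∫⁻ y in Metric.ball (x i) (α * r),
            ENNReal.ofReal (‖F y - ⨍ z in Metric.ball (x i) (α * r), F z‖ ^ 2))
          ≤ ENNReal.ofReal ε := by
  intro ε hε
  have hsq (v : E) : ENNReal.ofReal (‖v‖ ^ 2) = ‖v‖ₑ ^ 2 := by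
    rw [ENNReal.ofReal_pow (norm_nonneg v), ofReal_norm]
  simp_rw [hsq] at hF ⊢
  have hFL : MemLp F 2 := by
    refine ⟨hFm.aestronglyMeasurable, ?_⟩
    have h := eLpNorm_nnreal_pow_eq_lintegral (f := F) (μ := volume) (p := 2) two_ne_zero
    simp only [NNReal.coe_ofNat, ENNReal.rpow_ofNat, ENNReal.coe_ofNat] at h
    rw [← h] at hF
    simpa using hF
  obtain ⟨g, H, ρ, hρ, hHm, hH, hFg⟩ := exists_lintegral_le_and_enorm_sub_sq_le hFL
    (δ := ENNReal.ofReal (ε / (4 * (N + 1)))) (by simp; positivity)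
  refine ⟨ρ / 2, by positivity, fun r hr hrρ m x hx => ?_⟩
  have hball (i : Fin m) : ∫⁻ y in ball (x i) (α * r),
      ‖F y - ⨍ z in ball (x i) (α * r), F z‖ₑ ^ 2
        ≤ 4 * ∫⁻ y in ball (x i) (α * r), H y := by
    have : IsFiniteMeasure (volume.restrict (ball (x i) (α * r))) :=
      ⟨by simpa using measure_ball_lt_top⟩
    refine (lintegral_enorm_sub_average_sq_le
      ((hFL.restrict _).integrable one_le_two) (g (x i))).trans ?_
    gcongr 4 * ?_
    refine setLIntegral_mono' measurableSet_ball fun y hy => hFg _ _ ?_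
    have := mem_ball.1 hy
    nlinarith
  calc _ ≤ ∑ i, 4 * ∫⁻ y in ball (x i) (α * r), H y := Finset.sum_le_sum fun i _ => hball i
    _ = 4 * ∑ i, ∫⁻ y in ball (x i) (α * r), H y := by rw [Finset.mul_sum]
    _ ≤ 4 * (N * ENNReal.ofReal (ε / (4 * (N + 1)))) := by
      gcongr
      refine (sum_setLIntegral_le_of_ncard_le (fun i => measurableSet_ball)
        (fun y => ?_) hHm).trans (by gcongr)
      exact (Set.ncard_le_ncard (fun i (hi : y ∈ ball _ _) => show y ∈ closedBall (x i) (α * r) from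
        ball_subset_closedBall hi) (Set.toFinite _)).trans (hx y)
    _ = ENNReal.ofReal (4 * (N * (ε / (4 * (N + 1))))) := by
      rw [ENNReal.ofReal_mul (by norm_num), ENNReal.ofReal_mul (by positivity)]
      simp
    _ ≤ ENNReal.ofReal ε := by
      refine ENNReal.ofReal_le_ofReal ?_
      rw [show 4 * (N * (ε / (4 * (N + 1)))) = ε * (N / (N + 1)) by field_simp]
      exact mul_le_of_le_one_right hε.le (div_le_one_of_le₀ (by linarith) (by positivity))
end
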